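/- arXiv:1706.10258 — 2 statements merged into one kernel-verified Lean document; each statement's English description precedes it below -/
import Mathlib

section
/- For every integer n ≥ 1, in the polynomial ring ℤ[x_1,…,x_{n+1}], the ideal generated by the elementary symmetric polynomials σ_1,…,σ_{n+1} equals the ideal generated by σ_1, ξ_2,…,ξ_{n+1}, where for 2 ≤ l ≤ n+1, ξ_l = (1−l)·∑_{1≤i_1<⋯<i_l≤n+1} x_{i_1}⋯x_{i_l} − ∑ x_{i_1}⋯x_{i_{l−2}}·x_k², the second sum running over all 1 ≤ i_1 < ⋯ < i_{l−2} ≤ n+1 and all 1 ≤ k ≤ n+1 with k ∉ {i_1,…,i_{l−2}}. -/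
open MvPolynomial

/-- The polynomial `ξ_l ∈ ℤ[x_1,…,x_{n+1}]`:
`ξ_l = (1−l)·∑_{1≤i_1<⋯<i_l≤n+1} x_{i_1}⋯x_{i_l}
      − ∑ x_{i_1}⋯x_{i_{l−2}}·x_k²`,
the second sum over all `1 ≤ i_1 < ⋯ < i_{l−2} ≤ n+1` and `k ∉ {i_1,…,i_{l−2}}`. -/
noncomputable def xiPoly (n l : ℕ) : MvPolynomial (Fin (n + 1)) ℤ :=
  C (1 - (l : ℤ)) * ∑ s ∈ (Finset.univ : Finset (Fin (n + 1))).powersetCard l, ∏ i ∈ s, X i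
    - ∑ s ∈ (Finset.univ : Finset (Fin (n + 1))).powersetCard (l - 2),
        ∑ k ∈ Finset.univ \ s, (∏ i ∈ s, X i) * X k ^ 2

/-- Pairs of an `m`-element set and a point outside it correspond to pairs of an
`(m + 1)`-element set and a point inside it. -/
theorem Finset.sum_powersetCard_sdiff_insert {σ M : Type*} [Fintype σ] [DecidableEq σ]
    [AddCommMonoid M] (m : ℕ) (f : Finset σ → σ → M) :
    ∑ s ∈ (Finset.univ : Finset σ).powersetCard m, ∑ k ∈ Finset.univ \ s, f (insert k s) k
      = ∑ t ∈ (Finset.univ : Finset σ).powersetCard (m + 1), ∑ k ∈ t, f t k := by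
  rw [Finset.sum_sigma', Finset.sum_sigma']
  refine Finset.sum_bij' (fun p _ => ⟨insert p.2 p.1, p.2⟩) (fun p _ => ⟨p.1.erase p.2, p.2⟩)
    ?_ ?_ ?_ ?_ ?_
  all_goals
    rintro ⟨s, k⟩ h
    simp only [Finset.mem_sigma, Finset.mem_powersetCard, Finset.subset_univ, true_and,
      Finset.mem_sdiff, Finset.mem_univ] at h
    obtain ⟨h, hk⟩ := h
    simp [hk, h]

namespace MvPolynomial

/-- The product `σ₁ σ_{m+1}` in terms of `σ_{m+2}` and the monomial symmetric polynomial of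
shape `(2, 1^m)`. -/
theorem esymm_one_mul_esymm_succ (σ R : Type*) [Fintype σ] [DecidableEq σ] [CommSemiring R]
    (m : ℕ) :
    esymm σ R 1 * esymm σ R (m + 1) = (m + 2 : ℕ) * esymm σ R (m + 2)
      + ∑ s ∈ (Finset.univ : Finset σ).powersetCard m,
          ∑ k ∈ Finset.univ \ s, (∏ i ∈ s, X i) * X k ^ 2 := by
  have inside : ∑ s ∈ (Finset.univ : Finset σ).powersetCard m,
      ∑ k ∈ Finset.univ \ s, (∏ i ∈ s, (X i : MvPolynomial σ R)) * X k ^ 2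
      = ∑ t ∈ (Finset.univ : Finset σ).powersetCard (m + 1), ∑ k ∈ t, (∏ i ∈ t, X i) * X k := by
    rw [← Finset.sum_powersetCard_sdiff_insert]
    refine Finset.sum_congr rfl fun s _ => Finset.sum_congr rfl fun k hk => ?_
    rw [Finset.prod_insert (Finset.mem_sdiff.mp hk).2]
    ring
  have outside : (m + 2 : ℕ) * esymm σ R (m + 2)
      = ∑ t ∈ (Finset.univ : Finset σ).powersetCard (m + 1),
          ∑ k ∈ Finset.univ \ t, (∏ i ∈ t, X i) * X k := by
    trans ∑ u ∈ (Finset.univ : Finset σ).powersetCard (m + 2), ∑ _k ∈ u, ∏ i ∈ u, X i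
    · rw [esymm, Finset.mul_sum]
      refine Finset.sum_congr rfl fun u hu => ?_
      rw [Finset.sum_const, (Finset.mem_powersetCard.mp hu).2, nsmul_eq_mul]
    · rw [← Finset.sum_powersetCard_sdiff_insert (m + 1) fun u _ => ∏ i ∈ u, X i]
      refine Finset.sum_congr rfl fun s _ => Finset.sum_congr rfl fun k hk => ?_
      rw [Finset.prod_insert (Finset.mem_sdiff.mp hk).2, mul_comm]
  rw [inside, outside, ← Finset.sum_add_distrib, esymm_one, esymm, Finset.mul_sum]
  refine Finset.sum_congr rfl fun t _ => ?_
  rw [Finset.sum_sdiff (Finset.subset_univ t), ← Finset.mul_sum, mul_comm]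

end MvPolynomial

theorem xiPoly_eq_esymm_sub (n l : ℕ) (hl : 2 ≤ l) :
    xiPoly n l = esymm (Fin (n + 1)) ℤ l
      - esymm (Fin (n + 1)) ℤ 1 * esymm (Fin (n + 1)) ℤ (l - 1) := by
  obtain ⟨m, rfl⟩ := Nat.exists_eq_add_of_le' hl
  have h := esymm_one_mul_esymm_succ (Fin (n + 1)) ℤ m
  rw [show m + 2 - 1 = m + 1 from rfl, h, xiPoly, Nat.add_sub_cancel, ← esymm]
  simp only [map_sub, map_one, map_natCast]
  ring

/-- For `n ≥ 1`, in `ℤ[x_1,…,x_{n+1}]` the ideal generated by the elementary symmetric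
polynomials `σ_1,…,σ_{n+1}` equals the ideal generated by `σ_1, ξ_2, …, ξ_{n+1}`. -/
theorem span_esymm_eq_span_xi (n : ℕ) (hn : 1 ≤ n) :
    Ideal.span ((fun l => esymm (Fin (n + 1)) ℤ l) '' Set.Icc 1 (n + 1))
      = Ideal.span ({esymm (Fin (n + 1)) ℤ 1} ∪ xiPoly n '' Set.Icc 2 (n + 1)) := by
  apply le_antisymm <;> rw [Ideal.span_le]
  · have h1 : esymm (Fin (n + 1)) ℤ 1
        ∈ Ideal.span ({esymm (Fin (n + 1)) ℤ 1} ∪ xiPoly n '' Set.Icc 2 (n + 1)) :=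
      Ideal.subset_span (Or.inl rfl)
    rintro _ ⟨l, ⟨hl, hln⟩, rfl⟩
    obtain rfl | hl := hl.eq_or_lt
    · exact h1
    · have hxi : xiPoly n l
          ∈ Ideal.span ({esymm (Fin (n + 1)) ℤ 1} ∪ xiPoly n '' Set.Icc 2 (n + 1)) :=
        Ideal.subset_span (Or.inr ⟨l, ⟨hl, hln⟩, rfl⟩)
      rw [xiPoly_eq_esymm_sub n l hl] at hxi
      exact (Submodule.sub_mem_iff_left _ (Ideal.mul_mem_right _ _ h1)).mp hxi
  · have hmem : ∀ l ∈ Set.Icc 1 (n + 1), esymm (Fin (n + 1)) ℤ l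
        ∈ Ideal.span ((fun l => esymm (Fin (n + 1)) ℤ l) '' Set.Icc 1 (n + 1)) :=
      fun l hl => Ideal.subset_span ⟨l, hl, rfl⟩
    have h1 := hmem 1 ⟨le_rfl, by omega⟩
    rintro _ (rfl | ⟨l, ⟨hl, hln⟩, rfl⟩)
    · exact h1
    · rw [xiPoly_eq_esymm_sub n l hl]
      exact sub_mem (hmem l ⟨by omega, hln⟩) (Ideal.mul_mem_right _ _ h1)
end

section
/- For all integers n ≥ 1 and 2 ≤ l ≤ n+1, the following identity holds in ℤ[α_1,…,α_n,β_1,…,β_n]: ∑_{m=1}^{l} ∑ (α_{i_1}−β_{i_1})⋯(α_{i_m}−β_{i_m})·β_{i_{m+1}}⋯β_{i_l} = e_l(α_1,…,α_n) − e_l(β_1,…,β_n), where for each m the inner sum runs over all index sequences with 1 ≤ i_1 < ⋯ < i_m ≤ n, 1 ≤ i_{m+1} < ⋯ < i_l ≤ n, and i_1,…,i_l pairwise distinct, and e_l denotes the l-th elementary symmetric polynomial in n variables (so e_{n+1} = 0 and for l = n+1 the left-hand side is the empty sum 0 except for the m = n+1 term). -/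
open MvPolynomial

/-- The elementary symmetric sums of `f + g` expand as sums over pairs of disjoint finsets. -/
theorem sum_powersetCard_prod_add {ι R : Type*} [DecidableEq ι] [CommSemiring R]
    (s : Finset ι) (f g : ι → R) (l : ℕ) :
    ∑ S ∈ s.powersetCard l, ∏ i ∈ S, (f i + g i) =
      ∑ m ∈ Finset.range (l + 1), ∑ A ∈ s.powersetCard m, ∑ B ∈ (s \ A).powersetCard (l - m),
        (∏ i ∈ A, f i) * ∏ i ∈ B, g i := by
  have expand : ∀ S ∈ s.powersetCard l, ∏ i ∈ S, (f i + g i) =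
      ∑ m ∈ Finset.range (l + 1), ∑ A ∈ S.powersetCard m,
        (∏ i ∈ A, f i) * ∏ i ∈ S \ A, g i := by
    intro S hS
    rw [Finset.prod_add, Finset.sum_powerset, (Finset.mem_powersetCard.mp hS).2]
  rw [Finset.sum_congr rfl expand, Finset.sum_comm]
  refine Finset.sum_congr rfl fun m hm => ?_
  have hml : m ≤ l := Nat.lt_succ_iff.mp (Finset.mem_range.mp hm)
  rw [Finset.sum_sigma', Finset.sum_sigma']
  refine Finset.sum_bij' (fun p _ => ⟨p.2, p.1 \ p.2⟩) (fun p _ => ⟨p.1 ∪ p.2, p.1⟩)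
    ?_ ?_ ?_ ?_ (fun _ _ => rfl)
  · rintro ⟨S, A⟩ h
    simp only [Finset.mem_sigma, Finset.mem_powersetCard] at h ⊢
    obtain ⟨⟨hS, hSl⟩, hA, hAm⟩ := h
    exact ⟨⟨hA.trans hS, hAm⟩, Finset.sdiff_subset_sdiff hS subset_rfl,
      by rw [Finset.card_sdiff_of_subset hA, hSl, hAm]⟩
  · rintro ⟨A, B⟩ h
    simp only [Finset.mem_sigma, Finset.mem_powersetCard, Finset.subset_sdiff] at h ⊢
    obtain ⟨⟨hA, hAm⟩, ⟨hB, hBA⟩, hBm⟩ := h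
    exact ⟨⟨Finset.union_subset hA hB,
      by rw [Finset.card_union_of_disjoint hBA.symm, hAm, hBm, Nat.add_sub_cancel' hml]⟩,
      Finset.subset_union_left, hAm⟩
  · rintro ⟨S, A⟩ h
    simp only [Finset.mem_sigma, Finset.mem_powersetCard] at h
    simp [Finset.union_sdiff_of_subset h.2.1]
  · rintro ⟨A, B⟩ h
    simp only [Finset.mem_sigma, Finset.mem_powersetCard, Finset.subset_sdiff] at h
    simp [Finset.union_sdiff_cancel_left h.2.1.2.symm]

/-- For `n ≥ 1` and `2 ≤ l ≤ n+1`, in `ℤ[α_1,…,α_n,β_1,…,β_n]`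
(variables indexed by `Fin n ⊕ Fin n`, `α_i = X (inl i)`, `β_i = X (inr i)`):
`∑_{m=1}^{l} ∑ (α_{i_1}−β_{i_1})⋯(α_{i_m}−β_{i_m})·β_{i_{m+1}}⋯β_{i_l}
  = e_l(α) − e_l(β)`,
the inner sum over pairs of disjoint index sets `{i_1<⋯<i_m}` and `{i_{m+1}<⋯<i_l}`
(encoded as disjoint finsets `A` of size `m` and `B` of size `l−m`). -/
theorem transgression_esymm_identity (n l : ℕ) (hn : 1 ≤ n) (hl2 : 2 ≤ l)
    (hl : l ≤ n + 1) :
    ∑ m ∈ Finset.Icc 1 l,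
        ∑ A ∈ (Finset.univ : Finset (Fin n)).powersetCard m,
          ∑ B ∈ (Finset.univ \ A).powersetCard (l - m),
            (∏ i ∈ A, ((X (Sum.inl i) : MvPolynomial (Fin n ⊕ Fin n) ℤ) - X (Sum.inr i)))
              * ∏ i ∈ B, X (Sum.inr i)
      = (∑ S ∈ (Finset.univ : Finset (Fin n)).powersetCard l, ∏ i ∈ S,
            (X (Sum.inl i) : MvPolynomial (Fin n ⊕ Fin n) ℤ))
        - ∑ S ∈ (Finset.univ : Finset (Fin n)).powersetCard l, ∏ i ∈ S, X (Sum.inr i) := by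
  have key := sum_powersetCard_prod_add (Finset.univ : Finset (Fin n))
    (fun i => (X (Sum.inl i) : MvPolynomial (Fin n ⊕ Fin n) ℤ) - X (Sum.inr i))
    (fun i => X (Sum.inr i)) l
  simp only [sub_add_cancel] at key
  rw [key, Finset.range_eq_Ico, Finset.sum_eq_sum_Ico_succ_bot l.succ_pos]
  simp only [Finset.powersetCard_zero, Finset.sum_singleton, Finset.prod_empty, one_mul,
    Finset.sdiff_empty, Nat.sub_zero, add_sub_cancel_left]
  rfl
end
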